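/- Let n be even, let π(i) = (C(n,i) − C(n,i−1))/C(n, n/2) for 1 ≤ i ≤ n/2 and π(0) = 1/C(n, n/2), and let K be the birth-death transition matrix on {0,1,…,n/2} with K(i,i+1) := (n−i+1)/(n(n−2i)(n−2i+1)) for i < n/2, K(n/2, n/2+1) := 0, K(i,i−1) := i/(n(n−2i+1)(n−2i+2)), and K(i,i) := 1 − K(i,i+1) − K(i,i−1). Then K is reversible with respect to π, i.e., π(i)·K(i,j) = π(j)·K(j,i) for all i, j ∈ {0,1,…,n/2}. -/

import Mathlib

open Finset

/-- The spectral measure of the Bernoulli-Laplace chain. -/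
noncomputable def piBL (n i : ℕ) : ℝ :=
  if i = 0 then 1 / (n.choose (n / 2) : ℝ)
  else ((n.choose i : ℝ) - (n.choose (i - 1) : ℝ)) / (n.choose (n / 2) : ℝ)

/-- The rescaled eigenvalue `W(i) = (n-2i)(n+2-2i)/(2n)`. -/
noncomputable def WBL (n i : ℕ) : ℝ :=
  ((n : ℝ) - 2 * i) * ((n : ℝ) + 2 - 2 * i) / (2 * n)

/-- Up-transition probability of the first birth-death chain:
`K(i,i+1) = (n-i+1)/(n(n-2i)(n-2i+1))` for `i < n/2`, and `K(n/2, n/2+1) = 0`. -/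
noncomputable def upBL (n i : ℕ) : ℝ :=
  if i < n / 2 then ((n : ℝ) - i + 1) / ((n : ℝ) * ((n : ℝ) - 2 * i) * ((n : ℝ) - 2 * i + 1))
  else 0

/-- Down-transition probability: `K(i,i-1) = i/(n(n-2i+1)(n-2i+2))`. -/
noncomputable def downBL (n i : ℕ) : ℝ :=
  (i : ℝ) / ((n : ℝ) * ((n : ℝ) - 2 * i + 1) * ((n : ℝ) - 2 * i + 2))

/-- The birth-death transition matrix of Subsection 4.1. -/
noncomputable def KBL (n i j : ℕ) : ℝ :=
  if j = i + 1 then upBL n i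
  else if i = j + 1 then downBL n i
  else if i = j then 1 - upBL n i - downBL n i
  else 0

/-- Closed form of the spectral measure. -/
lemma piBL_eq {n i : ℕ} (hi : i ≤ n) :
    piBL n i = (n.choose i : ℝ) * ((n : ℝ) - 2 * i + 1) / ((n : ℝ) - i + 1) /
      (n.choose (n / 2) : ℝ) := by
  have hin : (i : ℝ) ≤ n := by exact_mod_cast hi
  have hd : (n : ℝ) - i + 1 ≠ 0 := by linarith
  unfold piBL
  rcases i with _ | k
  · have : (n : ℝ) + 1 ≠ 0 := by positivity
    simp [this]
  · rw [if_neg k.succ_ne_zero, Nat.add_sub_cancel]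
    congr 1
    rw [eq_div_iff hd]
    have h := congrArg (Nat.cast : ℕ → ℝ) (Nat.choose_succ_right_eq n k)
    rw [Nat.cast_mul, Nat.cast_mul, Nat.cast_sub (by omega)] at h
    push_cast at h ⊢
    linear_combination h

/-- Detailed balance between neighbouring states. -/
lemma piBL_mul_upBL {n i : ℕ} (hn : Even n) (hi : i + 1 ≤ n / 2) :
    piBL n i * upBL n i = piBL n (i + 1) * downBL n (i + 1) := by
  obtain ⟨m, rfl⟩ := hn
  have him : i + 1 ≤ m := by omega
  have hr : (i : ℝ) + 1 ≤ m := by exact_mod_cast him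
  have hi0 : (0 : ℝ) ≤ i := i.cast_nonneg
  have h := congrArg (Nat.cast : ℕ → ℝ) (Nat.choose_succ_right_eq (m + m) i)
  rw [Nat.cast_mul, Nat.cast_mul, Nat.cast_sub (by omega)] at h
  rw [piBL_eq (by omega), piBL_eq (by omega), upBL, if_pos (by omega), downBL]
  push_cast at h ⊢
  have hC : ((m + m).choose ((m + m) / 2) : ℝ) ≠ 0 := by
    exact_mod_cast (Nat.choose_pos (Nat.div_le_self _ _)).ne'
  have h0 : (m : ℝ) + m ≠ 0 := by linarith
  have h1 : (m : ℝ) + m - i + 1 ≠ 0 := by linarith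
  have h2 : (m : ℝ) + m - i ≠ 0 := by linarith
  have h3 : (m : ℝ) + m - 2 * i ≠ 0 := by linarith
  have h4 : (m : ℝ) + m - 2 * i + 1 ≠ 0 := by linarith
  have h5 : (m : ℝ) + m - 2 * i - 1 ≠ 0 := by linarith
  rw [show (m : ℝ) + m - (i + 1) + 1 = m + m - i by ring,
    show (m : ℝ) + m - 2 * (i + 1) + 1 = m + m - 2 * i - 1 by ring,
    show (m : ℝ) + m - 2 * (i + 1) + 2 = m + m - 2 * i by ring]
  generalize ((m + m).choose ((m + m) / 2) : ℝ) = C at *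
  generalize ((m + m).choose (i + 1) : ℝ) = B at *
  generalize ((m + m).choose i : ℝ) = A at *
  generalize (m : ℝ) + m - i + 1 = a at *
  generalize (m : ℝ) + m - 2 * i - 1 = b at *
  generalize (m : ℝ) + m - 2 * i + 1 = c at *
  generalize (m : ℝ) + m - 2 * i = d at *
  generalize (m : ℝ) + m - i = e at *
  generalize (m : ℝ) + m = f at *
  field_simp
  linear_combination -h

/-- The birth-death chain of Subsection 4.1 is reversible with respect to the spectral
measure `π` of the Bernoulli-Laplace chain. -/
theorem reversibility_v1 (n : ℕ) (hn : Even n) (hpos : 0 < n) :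
    ∀ i ≤ n / 2, ∀ j ≤ n / 2, piBL n i * KBL n i j = piBL n j * KBL n j i := by
  intro i hi j hj
  by_cases h1 : j = i + 1
  · subst h1
    simpa [KBL, show ∀ k : ℕ, k ≠ k + 1 + 1 by omega] using piBL_mul_upBL hn hj
  by_cases h2 : i = j + 1
  · subst h2
    simpa [KBL, show ∀ k : ℕ, k ≠ k + 1 + 1 by omega] using (piBL_mul_upBL hn hi).symm
  by_cases h3 : i = j
  · rw [h3]
  · simp [KBL, h1, h2, h3, Ne.symm h3]
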